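/- For a unit quaternion q ∈ ℍ (i.e., ‖q‖ = 1), M(q) equals the 3×3 identity matrix if and only if q = 1 or q = −1. That is, the fiber of the map M over the identity rotation consists exactly of the two unit quaternions 1 and −1. -/

import Mathlib

/-- For a quaternion `a = x + y·i + z·j + w·k`, the associated `3 × 3` real matrix of the
rotation it induces on `ℝ³` (Rodrigues / Euler–Rodrigues formula). -/
noncomputable def quatToMatrix (a : Quaternion ℝ) : Matrix (Fin 3) (Fin 3) ℝ :=
  !![a.re ^ 2 + a.imI ^ 2 - a.imJ ^ 2 - a.imK ^ 2,
      2 * (a.imI * a.imJ - a.re * a.imK),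
      2 * (a.imI * a.imK + a.re * a.imJ);
    2 * (a.imI * a.imJ + a.re * a.imK),
      a.re ^ 2 - a.imI ^ 2 + a.imJ ^ 2 - a.imK ^ 2,
      2 * (a.imJ * a.imK - a.re * a.imI);
    2 * (a.imI * a.imK - a.re * a.imJ),
      2 * (a.imJ * a.imK + a.re * a.imI),
      a.re ^ 2 - a.imI ^ 2 - a.imJ ^ 2 + a.imK ^ 2]

theorem stmt_17 (q : Quaternion ℝ) (hq : ‖q‖ = 1) :
    quatToMatrix q = 1 ↔ q = 1 ∨ q = -1 := by
  have hn : q.re ^ 2 + q.imI ^ 2 + q.imJ ^ 2 + q.imK ^ 2 = 1 := by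
    rw [← Quaternion.normSq_def', Quaternion.normSq_eq_norm_mul_self, hq, one_mul]
  constructor
  · intro h
    have h₀ : q.re ^ 2 + q.imI ^ 2 - q.imJ ^ 2 - q.imK ^ 2 = 1 := by
      simpa [quatToMatrix] using congrFun₂ h 0 0
    have h₁ : q.re ^ 2 - q.imI ^ 2 + q.imJ ^ 2 - q.imK ^ 2 = 1 := by
      simpa [quatToMatrix] using congrFun₂ h 1 1
    have hI : q.imI = 0 := by nlinarith [sq_nonneg q.imI, sq_nonneg q.imK]
    have hJ : q.imJ = 0 := by nlinarith [sq_nonneg q.imJ, sq_nonneg q.imK]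
    have hK : q.imK = 0 := by nlinarith [sq_nonneg q.imJ, sq_nonneg q.imK]
    have hre : q.re ^ 2 = 1 := by simpa [hI, hJ, hK] using hn
    refine (sq_eq_one_iff.mp hre).imp ?_ ?_ <;> intro hx <;> ext <;>
      simp [hx, hI, hJ, hK, Quaternion.re_one, Quaternion.imI_one, Quaternion.imJ_one,
        Quaternion.imK_one]
  · rintro (rfl | rfl) <;> ext i j <;> fin_cases i <;> fin_cases j <;>
      simp [quatToMatrix, Quaternion.re_one, Quaternion.imI_one, Quaternion.imJ_one,
        Quaternion.imK_one]
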